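/- If φ_ω ∈ X solves −Δφ_ω + (γ/2π)(∫ ln|x−y| |φ_ω(y)|^2 dy) φ_ω = ω φ_ω in R^2 with finite particle number N(φ_ω) = ∫|φ_ω|^2, then the virial identity T(φ_ω) = (γ/8π) N(φ_ω)^2 holds, where T(φ_ω) = ∫|∇φ_ω|^2. -/

import Mathlib

open MeasureTheory

noncomputable section

/-- The Laplacian of a function on `ℝ²`, as the trace of the second derivative. -/
def laplacian (φ : EuclideanSpace ℝ (Fin 2) → ℝ) (x : EuclideanSpace ℝ (Fin 2)) : ℝ :=
  ∑ i : Fin 2,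
    fderiv ℝ (fun y => fderiv ℝ φ y (EuclideanSpace.single i 1)) x
      (EuclideanSpace.single i 1)

open Filter Topology

/-- The Euclidean plane. -/
abbrev Plane := EuclideanSpace ℝ (Fin 2)

/-- The `i`-th partial derivative of a function on the plane. -/
def partialDeriv (i : Fin 2) (f : Plane → ℝ) (x : Plane) : ℝ :=
  fderiv ℝ f x (EuclideanSpace.single i 1)

/-- The divergence of a vector field on the plane. -/
def divergence (F : Fin 2 → Plane → ℝ) (x : Plane) : ℝ :=
  ∑ i, partialDeriv i (F i) x

lemma laplacian_eq_sum_partialDeriv (f : Plane → ℝ) (x : Plane) :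
    laplacian f x = ∑ i, partialDeriv i (partialDeriv i f) x := rfl

section PartialDeriv

variable {f g : Plane → ℝ} {i : Fin 2} {x : Plane}

lemma partialDeriv_add (hf : DifferentiableAt ℝ f x) (hg : DifferentiableAt ℝ g x) :
    partialDeriv i (fun y => f y + g y) x = partialDeriv i f x + partialDeriv i g x := by
  simp [partialDeriv, fderiv_fun_add hf hg]

lemma partialDeriv_mul (hf : DifferentiableAt ℝ f x) (hg : DifferentiableAt ℝ g x) :
    partialDeriv i (fun y => f y * g y) x = f x * partialDeriv i g x + g x * partialDeriv i f x := by
  simp [partialDeriv, fderiv_fun_mul hf hg]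

lemma partialDeriv_const_mul (c : ℝ) (hf : DifferentiableAt ℝ f x) :
    partialDeriv i (fun y => c * f y) x = c * partialDeriv i f x := by
  simp [partialDeriv, fderiv_const_mul hf]

lemma partialDeriv_comp_smul (c : ℝ) :
    partialDeriv i (fun y => f (c • y)) x = c * partialDeriv i f (c • x) := by
  simp [partialDeriv, fderiv_comp_smul]

lemma contDiff_partialDeriv {m n : WithTop ℕ∞} (hf : ContDiff ℝ n f) (h : m + 1 ≤ n) :
    ContDiff ℝ m (partialDeriv i f) :=
  (hf.fderiv_right h).clm_apply contDiff_const

lemma HasCompactSupport.partialDeriv (hf : HasCompactSupport f) :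
    HasCompactSupport (partialDeriv i f) :=
  hf.fderiv_apply ℝ _

lemma partialDeriv_comm (hf : ContDiff ℝ 2 f) (i j : Fin 2) (x : Plane) :
    partialDeriv i (partialDeriv j f) x = partialDeriv j (partialDeriv i f) x := by
  have hd : DifferentiableAt ℝ (fderiv ℝ f) x :=
    ((hf.fderiv_right (m := 1) (by norm_num)).differentiable (by norm_num)) x
  have key (i j : Fin 2) : partialDeriv i (partialDeriv j f) x
      = fderiv ℝ (fderiv ℝ f) x (EuclideanSpace.single i 1) (EuclideanSpace.single j 1) := by
    unfold partialDeriv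
    rw [fderiv_clm_apply hd (differentiableAt_const _)]
    simp
  rw [key, key]
  exact (hf.contDiffAt.isSymmSndFDerivAt (by simp)) _ _

lemma integral_partialDeriv (hf : ContDiff ℝ 1 f) (hc : HasCompactSupport f) :
    ∫ x, partialDeriv i f x = 0 := by
  have h := integral_mul_fderiv_eq_neg_fderiv_mul_of_integrable (μ := (volume : Measure Plane))
    (f := fun _ => (1 : ℝ)) (g := f) (v := EuclideanSpace.single i 1) (by simp)
    (by
      simp only [one_mul]
      exact (contDiff_partialDeriv (m := 0) (i := i) hf
        (by norm_num)).continuous.integrable_of_hasCompactSupport hc.partialDeriv)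
    (by simpa using hf.continuous.integrable_of_hasCompactSupport hc)
    (fun _ _ => differentiableAt_const _) (fun x _ => hf.differentiable (by norm_num) x)
  simpa [partialDeriv] using h

end PartialDeriv

section Divergence

variable {F : Fin 2 → Plane → ℝ}

lemma continuous_divergence (hF : ∀ i, ContDiff ℝ 1 (F i)) : Continuous (divergence F) :=
  continuous_finsetSum _ fun i _ =>
    (contDiff_partialDeriv (m := 0) (hF i) (by norm_num)).continuous

lemma hasCompactSupport_divergence (hc : ∀ i, HasCompactSupport (F i)) :
    HasCompactSupport (divergence F) := by
  have : divergence F = fun x => partialDeriv 0 (F 0) x + partialDeriv 1 (F 1) x := by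
    ext x; simp [divergence]
  rw [this]
  exact (hc 0).partialDeriv.add (hc 1).partialDeriv

lemma integral_divergence (hF : ∀ i, ContDiff ℝ 1 (F i)) (hc : ∀ i, HasCompactSupport (F i)) :
    ∫ x, divergence F x = 0 := by
  unfold divergence
  rw [integral_finsetSum]
  · exact Finset.sum_eq_zero fun i _ => integral_partialDeriv (hF i) (hc i)
  · exact fun i _ => (contDiff_partialDeriv (m := 0) (hF i)
      (by norm_num)).continuous.integrable_of_hasCompactSupport (hc i).partialDeriv

end Divergence

section Pohozaev

variable {φ : Plane → ℝ} {X : Fin 2 → Plane → ℝ}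

/-- The multiplier `X · ∇φ + (div X / 2) φ` of the Pohozaev identity. -/
def pohozaevMultiplier (X : Fin 2 → Plane → ℝ) (φ : Plane → ℝ) (x : Plane) : ℝ :=
  ∑ i, X i x * partialDeriv i φ x + 2⁻¹ * (divergence X x * φ x)

/-- The quadratic form `DX(∇φ, ∇φ) + (φ ∇φ · ∇ div X) / 2` of the Pohozaev identity. -/
def pohozaevForm (X : Fin 2 → Plane → ℝ) (φ : Plane → ℝ) (x : Plane) : ℝ :=
  ∑ j, ((∑ i, partialDeriv j (X i) x * partialDeriv i φ x * partialDeriv j φ x)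
    + 2⁻¹ * (φ x * partialDeriv j φ x * partialDeriv j (divergence X) x))

lemma contDiff_divergence (hX : ∀ i, ContDiff ℝ 2 (X i)) : ContDiff ℝ 1 (divergence X) :=
  ContDiff.sum fun i _ => contDiff_partialDeriv (hX i) (by norm_num)

lemma contDiff_pohozaevMultiplier (hφ : ContDiff ℝ 2 φ) (hX : ∀ i, ContDiff ℝ 2 (X i)) :
    ContDiff ℝ 1 (pohozaevMultiplier X φ) :=
  (ContDiff.sum fun i _ => ((hX i).of_le (by norm_num)).mul
    (contDiff_partialDeriv hφ (by norm_num))).add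
    (contDiff_const.mul ((contDiff_divergence hX).mul (hφ.of_le (by norm_num))))

lemma hasCompactSupport_pohozaevMultiplier (hc : ∀ i, HasCompactSupport (X i)) :
    HasCompactSupport (pohozaevMultiplier X φ) := by
  have : pohozaevMultiplier X φ = fun x => (X 0 x * partialDeriv 0 φ x
      + X 1 x * partialDeriv 1 φ x) + 2⁻¹ * (divergence X x * φ x) := by
    ext x; simp [pohozaevMultiplier]
  rw [this]
  exact ((hc 0).mul_right.add (hc 1).mul_right).add
    (HasCompactSupport.mul_left (hasCompactSupport_divergence hc).mul_right)

lemma integrable_laplacian_mul_pohozaevMultiplier (hφ : ContDiff ℝ 2 φ)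
    (hX : ∀ i, ContDiff ℝ 2 (X i)) (hc : ∀ i, HasCompactSupport (X i)) :
    Integrable fun x => laplacian φ x * pohozaevMultiplier X φ x := by
  refine Continuous.integrable_of_hasCompactSupport ?_
    (HasCompactSupport.mul_left (hasCompactSupport_pohozaevMultiplier hc))
  exact (continuous_divergence (F := fun i => partialDeriv i φ)
    fun i => contDiff_partialDeriv hφ (by norm_num)).mul
    (contDiff_pohozaevMultiplier hφ hX).continuous

lemma integral_laplacian_mul_pohozaevMultiplier (hφ : ContDiff ℝ 2 φ)
    (hX : ∀ i, ContDiff ℝ 2 (X i)) (hc : ∀ i, HasCompactSupport (X i)) :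
    ∫ x, laplacian φ x * pohozaevMultiplier X φ x = -∫ x, pohozaevForm X φ x := by
  have hp (i) : ContDiff ℝ 1 (partialDeriv i φ) := contDiff_partialDeriv hφ (by norm_num)
  have hψ := contDiff_pohozaevMultiplier hφ hX
  have hX' (i) : ContDiff ℝ 1 (X i) := (hX i).of_le (by norm_num)
  let F : Fin 2 → Plane → ℝ := fun j x => partialDeriv j φ x * pohozaevMultiplier X φ x
    + (-2⁻¹) * (X j x * (partialDeriv 0 φ x * partialDeriv 0 φ x
      + partialDeriv 1 φ x * partialDeriv 1 φ x))
  have hF (j) : ContDiff ℝ 1 (F j) := ((hp j).mul hψ).add (contDiff_const.mul ((hX' j).mul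
    (((hp 0).mul (hp 0)).add ((hp 1).mul (hp 1)))))
  have hcF (j) : HasCompactSupport (F j) :=
    (HasCompactSupport.mul_left (hasCompactSupport_pohozaevMultiplier hc)).add
      (HasCompactSupport.mul_left (hc j).mul_right)
  have hdiv (x) : divergence F x
      = laplacian φ x * pohozaevMultiplier X φ x + pohozaevForm X φ x := by
    have dp (i) : DifferentiableAt ℝ (partialDeriv i φ) x := (hp i).differentiable (by norm_num) x
    have dX (i) : DifferentiableAt ℝ (X i) x := (hX' i).differentiable (by norm_num) x
    have dφ : DifferentiableAt ℝ φ x := hφ.differentiable (by norm_num) x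
    have dD : DifferentiableAt ℝ (divergence X) x :=
      (contDiff_divergence hX).differentiable (by norm_num) x
    have dψ : DifferentiableAt ℝ (pohozaevMultiplier X φ) x := hψ.differentiable (by norm_num) x
    have e1 (j) : partialDeriv j (pohozaevMultiplier X φ) x
        = X 0 x * partialDeriv j (partialDeriv 0 φ) x + partialDeriv 0 φ x * partialDeriv j (X 0) x
        + (X 1 x * partialDeriv j (partialDeriv 1 φ) x + partialDeriv 1 φ x * partialDeriv j (X 1) x)
        + 2⁻¹ * (divergence X x * partialDeriv j φ x + φ x * partialDeriv j (divergence X) x) := by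
      have : pohozaevMultiplier X φ = fun x => (X 0 x * partialDeriv 0 φ x
          + X 1 x * partialDeriv 1 φ x) + 2⁻¹ * (divergence X x * φ x) := by
        ext x; simp [pohozaevMultiplier]
      rw [this, partialDeriv_add (((dX 0).fun_mul (dp 0)).fun_add ((dX 1).fun_mul (dp 1)))
        ((dD.fun_mul dφ).const_mul _), partialDeriv_add ((dX 0).fun_mul (dp 0))
        ((dX 1).fun_mul (dp 1)), partialDeriv_mul (dX 0) (dp 0), partialDeriv_mul (dX 1) (dp 1),
        partialDeriv_const_mul _ (dD.fun_mul dφ), partialDeriv_mul dD dφ]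
    have e2 (j) : partialDeriv j (F j) x = partialDeriv j φ x
        * partialDeriv j (pohozaevMultiplier X φ) x
        + pohozaevMultiplier X φ x * partialDeriv j (partialDeriv j φ) x
        + (-2⁻¹) * (X j x * (2 * (partialDeriv 0 φ x * partialDeriv j (partialDeriv 0 φ) x
          + partialDeriv 1 φ x * partialDeriv j (partialDeriv 1 φ) x))
          + (partialDeriv 0 φ x * partialDeriv 0 φ x
            + partialDeriv 1 φ x * partialDeriv 1 φ x) * partialDeriv j (X j) x) := by
      have dpp (i) := (dp i).fun_mul (dp i)
      rw [partialDeriv_add ((dp j).fun_mul dψ)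
        (((dX j).fun_mul ((dpp 0).fun_add (dpp 1))).const_mul _), partialDeriv_mul (dp j) dψ,
        partialDeriv_const_mul _ ((dX j).fun_mul ((dpp 0).fun_add (dpp 1))),
        partialDeriv_mul (dX j) ((dpp 0).fun_add (dpp 1)), partialDeriv_add (dpp 0) (dpp 1),
        partialDeriv_mul (dp 0) (dp 0), partialDeriv_mul (dp 1) (dp 1)]
      ring
    rw [laplacian_eq_sum_partialDeriv, pohozaevForm]
    unfold divergence at *
    simp only [Fin.sum_univ_two, e2, e1] at *
    rw [partialDeriv_comm hφ 0 1 x]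
    ring
  have hzero := integral_divergence hF hcF
  have hlap := integrable_laplacian_mul_pohozaevMultiplier hφ hX hc
  have hform : Integrable (pohozaevForm X φ) := by
    have := ((continuous_divergence hF).integrable_of_hasCompactSupport
      (hasCompactSupport_divergence hcF)).sub hlap
    refine this.congr (ae_of_all _ fun x => ?_)
    simp [hdiv]
  simp only [hdiv] at hzero
  rw [integral_add hlap hform] at hzero
  linarith

lemma two_mul_mul_pohozaevMultiplier (hφ : ContDiff ℝ 2 φ) (hX : ∀ i, ContDiff ℝ 2 (X i))
    (x : Plane) : 2 * (φ x * pohozaevMultiplier X φ x)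
      = divergence (fun i x => X i x * φ x ^ 2) x := by
  have dX (i) : DifferentiableAt ℝ (X i) x := (hX i).differentiable (by norm_num) x
  have dφ : DifferentiableAt ℝ φ x := hφ.differentiable (by norm_num) x
  have e (i) : partialDeriv i (fun x => X i x * φ x ^ 2) x
      = X i x * (2 * (φ x * partialDeriv i φ x)) + φ x ^ 2 * partialDeriv i (X i) x := by
    simp only [pow_two]
    rw [partialDeriv_mul (dX i) (dφ.fun_mul dφ), partialDeriv_mul dφ dφ]
    ring
  simp only [pohozaevMultiplier, divergence, Fin.sum_univ_two, e]
  ring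

end Pohozaev

section LogKernel

lemma integrableOn_log_norm_ball : IntegrableOn (fun z : Plane => Real.log ‖z‖)
    (Metric.ball 0 1) := by
  rw [integrableOn_fun_norm_addHaar]
  simp only [finrank_euclideanSpace, Fintype.card_fin, Nat.add_one_sub_one, pow_one, smul_eq_mul]
  exact (Real.continuous_mul_log.continuousOn.integrableOn_compact isCompact_Icc).mono_set
    Set.Ioo_subset_Icc_self

lemma ae_fst_ne_snd : ∀ᵐ p : Plane × Plane, p.1 ≠ p.2 := by
  have hm : MeasurableSet {p : Plane × Plane | p.1 ≠ p.2} :=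
    (isClosed_eq continuous_fst continuous_snd).measurableSet.compl
  refine (Measure.ae_prod_iff_ae_ae hm).2 (ae_of_all _ fun x => ?_)
  filter_upwards [compl_mem_ae_iff.2 (measure_singleton (μ := (volume : Measure Plane)) x)]
    with y hy using fun h => hy h.symm

lemma log_one_add_norm_sub_le (x y : Plane) :
    Real.log (1 + ‖x - y‖) ≤ Real.log (1 + ‖x‖) + Real.log (1 + ‖y‖) := by
  rw [← Real.log_mul (by positivity) (by positivity)]
  refine Real.log_le_log (by positivity) ?_
  nlinarith [norm_sub_le x y, mul_nonneg (norm_nonneg x) (norm_nonneg y)]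

lemma log_one_add_norm_nonneg (x : Plane) : 0 ≤ Real.log (1 + ‖x‖) :=
  Real.log_nonneg (by linarith [norm_nonneg x])

lemma abs_log_norm_le (z : Plane) : |Real.log ‖z‖|
    ≤ (Metric.ball 0 1).indicator (fun z : Plane => |Real.log ‖z‖|) z
      + Real.log (1 + ‖z‖) := by
  by_cases hz : z ∈ Metric.ball (0 : Plane) 1
  · rw [Set.indicator_of_mem hz]
    linarith [log_one_add_norm_nonneg z]
  · rw [Set.indicator_of_notMem hz]
    have h1 : 1 ≤ ‖z‖ := by simpa using hz
    rw [abs_of_nonneg (Real.log_nonneg h1), zero_add]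
    exact Real.log_le_log (by linarith) (by linarith)

variable {ρ g : Plane → ℝ} {X : Fin 2 → Plane → ℝ} {ε : ℝ}

/-- The weight dominating both `log ‖z‖` and its regularizations. -/
def logWeight (z : Plane) : ℝ := |Real.log ‖z‖| + Real.log (1 + ‖z‖)

lemma integrable_logWeight_mul (hρ : Integrable ρ)
    (hlog : Integrable fun x => Real.log (1 + ‖x‖) * ρ x)
    (hg : Continuous g) (hgc : HasCompactSupport g) :
    Integrable fun p : Plane × Plane => logWeight (p.1 - p.2) * (ρ p.2 * g p.1) := by
  obtain ⟨C, hC⟩ := hgc.exists_bound_of_continuous hg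
  have hgi : Integrable g := hg.integrable_of_hasCompactSupport hgc
  have hgl : Integrable fun x => Real.log (1 + ‖x‖) * g x := by
    refine Continuous.integrable_of_hasCompactSupport ?_ (HasCompactSupport.mul_left hgc)
    exact (Continuous.log (by fun_prop) fun x => by positivity).mul hg
  have hball : Integrable
      ((Metric.ball 0 1).indicator (fun z : Plane => |Real.log ‖z‖|)) :=
    IntegrableOn.integrable_indicator integrableOn_log_norm_ball.abs
      Metric.isOpen_ball.measurableSet
  have hconv := (hρ.convolution_integrand (ContinuousLinearMap.mul ℝ ℝ) hball).bdd_mul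
    (f := fun p : Plane × Plane => g p.1) (c := C)
    (by fun_prop) (ae_of_all _ fun p => hC p.1)
  have h1 := hgl.mul_prod hρ
  have h2 := hgi.mul_prod hlog
  refine ((hconv.norm).add ((h1.norm.add h2.norm).const_mul 2)).mono' ?_
    (ae_of_all _ fun p => ?_)
  · refine AEStronglyMeasurable.mul ?_ (hρ.aestronglyMeasurable.comp_snd.mul (by fun_prop))
    unfold logWeight
    exact Measurable.aestronglyMeasurable (by fun_prop)
  · have ha := abs_log_norm_le (p.1 - p.2)
    have hb := log_one_add_norm_sub_le p.1 p.2
    have hi : 0 ≤ (Metric.ball 0 1).indicator (fun z : Plane => |Real.log ‖z‖|) (p.1 - p.2) :=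
      Set.indicator_nonneg (fun _ _ => abs_nonneg _) _
    have h0 : 0 ≤ logWeight (p.1 - p.2) :=
      add_nonneg (abs_nonneg _) (log_one_add_norm_nonneg _)
    have hw : logWeight (p.1 - p.2) ≤
        (Metric.ball 0 1).indicator (fun z : Plane => |Real.log ‖z‖|) (p.1 - p.2)
          + 2 * (Real.log (1 + ‖p.1‖) + Real.log (1 + ‖p.2‖)) := by
      unfold logWeight; linarith
    simp only [Pi.add_apply, norm_mul, Real.norm_eq_abs, ContinuousLinearMap.mul_apply',
      abs_of_nonneg hi, abs_of_nonneg h0, abs_of_nonneg (log_one_add_norm_nonneg _)]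
    calc _ ≤ _ * (|ρ p.2| * |g p.1|) := mul_le_mul_of_nonneg_right hw (by positivity)
      _ = _ := by ring

lemma integrable_log_norm_mul (hρ : Integrable ρ)
    (hlog : Integrable fun x => Real.log (1 + ‖x‖) * ρ x)
    (hg : Continuous g) (hgc : HasCompactSupport g) :
    Integrable fun p : Plane × Plane => Real.log ‖p.1 - p.2‖ * (ρ p.2 * g p.1) := by
  refine (integrable_logWeight_mul hρ hlog hg hgc).mono
    (AEStronglyMeasurable.mul (Measurable.aestronglyMeasurable (by fun_prop))
      (hρ.aestronglyMeasurable.comp_snd.mul (by fun_prop)))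
    (ae_of_all _ fun p => ?_)
  simp only [norm_mul]
  refine mul_le_mul_of_nonneg_right ?_ (by positivity)
  have := log_one_add_norm_nonneg (p.1 - p.2)
  rw [logWeight, Real.norm_eq_abs, Real.norm_eq_abs, abs_of_nonneg (a := _ + _) (by positivity)]
  linarith

/-- The regularization `log √(‖z‖² + ε)` of the logarithmic kernel. -/
def regLog (ε : ℝ) (z : Plane) : ℝ := 2⁻¹ * Real.log (‖z‖ ^ 2 + ε)

lemma contDiff_regLog (hε : 0 < ε) : ContDiff ℝ 1 (regLog ε) :=
  contDiff_const.mul (((contDiff_norm_sq ℝ).add contDiff_const).log fun z => by positivity)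

lemma partialDeriv_regLog_sub (hε : 0 < ε) (i : Fin 2) (x y : Plane) :
    partialDeriv i (fun x => regLog ε (x - y)) x = (x i - y i) / (‖x - y‖ ^ 2 + ε) := by
  have h : HasFDerivAt (fun x : Plane => x - y) (ContinuousLinearMap.id ℝ Plane) x :=
    (hasFDerivAt_id x).sub_const y
  have h2 := ((h.norm_sq.add_const ε).log (by positivity)).const_mul (2⁻¹ : ℝ)
  unfold partialDeriv regLog
  rw [h2.fderiv]
  simp [EuclideanSpace.inner_single_right]
  field_simp

lemma abs_regLog_le (hε : 0 < ε) (hε1 : ε ≤ 1) {z : Plane} (hz : z ≠ 0) :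
    |regLog ε z| ≤ logWeight z := by
  have hz' : 0 < ‖z‖ := norm_pos_iff.2 hz
  have h1 : Real.log ‖z‖ ≤ regLog ε z := by
    have := Real.log_le_log (by positivity) (show ‖z‖ ^ 2 ≤ ‖z‖ ^ 2 + ε by linarith)
    rw [Real.log_pow] at this
    unfold regLog
    push_cast at this
    linarith
  have h2 : regLog ε z ≤ Real.log (1 + ‖z‖) := by
    have := Real.log_le_log (by positivity)
      (show ‖z‖ ^ 2 + ε ≤ (1 + ‖z‖) ^ 2 by nlinarith)
    rw [Real.log_pow] at this
    unfold regLog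
    push_cast at this
    linarith
  unfold logWeight
  rw [abs_le]
  constructor <;> linarith [neg_abs_le (Real.log ‖z‖), log_one_add_norm_nonneg z,
    abs_nonneg (Real.log ‖z‖)]

lemma tendsto_regLog {z : Plane} (hz : z ≠ 0) :
    Tendsto (fun ε => regLog ε z) (𝓝[>] 0) (𝓝 (Real.log ‖z‖)) := by
  have hz' : 0 < ‖z‖ := norm_pos_iff.2 hz
  have hc : ContinuousAt (fun ε => regLog ε z) 0 := by
    unfold regLog
    exact continuousAt_const.mul (ContinuousAt.log (by fun_prop) (by positivity))
  have h0 : regLog 0 z = Real.log ‖z‖ := by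
    simp [regLog, Real.log_pow]
  rw [← h0]
  exact hc.tendsto.mono_left nhdsWithin_le_nhds

/-- The symmetrized kernel `(X(x) - X(y)) · (x - y) / (‖x - y‖² + ε)`. -/
def virialKernel (X : Fin 2 → Plane → ℝ) (ε : ℝ) (p : Plane × Plane) : ℝ :=
  ∑ i, (X i p.1 - X i p.2) * ((p.1 i - p.2 i) / (‖p.1 - p.2‖ ^ 2 + ε))

lemma abs_coord_le_norm (z : Plane) (i : Fin 2) : |z i| ≤ ‖z‖ := by
  simpa using PiLp.norm_apply_le z i

lemma integrable_regLog_mul (hε : 0 < ε) (hε1 : ε ≤ 1) (hρ : Integrable ρ)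
    (hlog : Integrable fun x => Real.log (1 + ‖x‖) * ρ x)
    (hg : Continuous g) (hgc : HasCompactSupport g) :
    Integrable fun p : Plane × Plane => regLog ε (p.1 - p.2) * (ρ p.2 * g p.1) := by
  refine (integrable_logWeight_mul hρ hlog hg hgc).mono
    (AEStronglyMeasurable.mul ?_ (hρ.aestronglyMeasurable.comp_snd.mul (by fun_prop))) ?_
  · exact ((contDiff_regLog hε).continuous.comp
      (continuous_fst.sub continuous_snd)).aestronglyMeasurable
  · filter_upwards [ae_fst_ne_snd] with p hp
    simp only [norm_mul]
    refine mul_le_mul_of_nonneg_right ?_ (by positivity)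
    exact (abs_regLog_le hε hε1 (sub_ne_zero.2 hp)).trans (le_abs_self _)

lemma integrable_gradient_kernel (hε : 0 < ε) (hρ : Integrable ρ) (hg : Integrable g)
    (i : Fin 2) : Integrable fun p : Plane × Plane =>
      (p.1 i - p.2 i) / (‖p.1 - p.2‖ ^ 2 + ε) * (g p.1 * ρ p.2) := by
  refine (hg.mul_prod hρ).bdd_mul (c := 1 + ε⁻¹) ?_ (ae_of_all _ fun p => ?_)
  · refine Continuous.aestronglyMeasurable (Continuous.div (by fun_prop) (by fun_prop) ?_)
    intro p; positivity
  · rw [norm_div, Real.norm_eq_abs, Real.norm_of_nonneg (by positivity),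
      div_le_iff₀ (by positivity)]
    have h1 := abs_coord_le_norm (p.1 - p.2) i
    have h2 : (1 + ε⁻¹) * (‖p.1 - p.2‖ ^ 2 + ε)
        = ‖p.1 - p.2‖ ^ 2 + ε + ε⁻¹ * ‖p.1 - p.2‖ ^ 2 + 1 := by field_simp; ring
    have h3 : 0 ≤ ε⁻¹ * ‖p.1 - p.2‖ ^ 2 := by positivity
    rw [h2]
    simp only [PiLp.sub_apply] at h1
    nlinarith [sq_nonneg (‖p.1 - p.2‖ - 1)]

lemma integral_regLog_mul_divergence (hε : 0 < ε) (hε1 : ε ≤ 1) (hρc : ContDiff ℝ 1 ρ)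
    (hρ : Integrable ρ) (hlog : Integrable fun x => Real.log (1 + ‖x‖) * ρ x)
    (hX : ∀ i, ContDiff ℝ 1 (X i)) (hc : ∀ i, HasCompactSupport (X i)) :
    ∫ p : Plane × Plane, regLog ε (p.1 - p.2) *
        (ρ p.2 * divergence (fun i x => X i x * ρ x) p.1)
      = -(2⁻¹ * ∫ p : Plane × Plane, virialKernel X ε p * (ρ p.1 * ρ p.2)) := by
  have hY (i) : ContDiff ℝ 1 (fun x => X i x * ρ x) := (hX i).mul hρc
  have hYc (i) : HasCompactSupport (fun x => X i x * ρ x) := (hc i).mul_right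
  have hYi (i) : Integrable (fun x => X i x * ρ x) :=
    (hY i).continuous.integrable_of_hasCompactSupport (hYc i)
  have hG := continuous_divergence hY
  have hGc := hasCompactSupport_divergence hYc
  let J : Plane × Plane → ℝ := fun p => ∑ i, (p.1 i - p.2 i) / (‖p.1 - p.2‖ ^ 2 + ε)
    * (X i p.1 * ρ p.1 * ρ p.2)
  have hJ : Integrable J :=
    integrable_finsetSum _ fun i _ => integrable_gradient_kernel hε hρ (hYi i) i
  have hLd (y) : ContDiff ℝ 1 fun x => regLog ε (x - y) :=
    (contDiff_regLog hε).comp (contDiff_id.sub contDiff_const)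
  have inner (y : Plane) : ∫ x, regLog ε (x - y) * (ρ y * divergence (fun i x => X i x * ρ x) x)
      = -∫ x, J (x, y) := by
    let F : Fin 2 → Plane → ℝ := fun i x => regLog ε (x - y) * (X i x * ρ x)
    have hF (i) : ContDiff ℝ 1 (F i) := (hLd y).mul (hY i)
    have hFc (i) : HasCompactSupport (F i) := HasCompactSupport.mul_left (hYc i)
    have hdiv (x) : regLog ε (x - y) * (ρ y * divergence (fun i x => X i x * ρ x) x)
        = ρ y * divergence F x - J (x, y) := by
      have e (i) : partialDeriv i (F i) x = _ :=
        partialDeriv_mul ((hLd y).differentiable (by norm_num) x)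
          ((hY i).differentiable (by norm_num) x)
      simp only [divergence, Fin.sum_univ_two, e, partialDeriv_regLog_sub hε, J]
      ring
    have hi1 : Integrable fun x => ρ y * divergence F x :=
      ((continuous_divergence hF).integrable_of_hasCompactSupport
        (hasCompactSupport_divergence hFc)).const_mul _
    have hi2 : Integrable fun x => regLog ε (x - y)
        * (ρ y * divergence (fun i x => X i x * ρ x) x) :=
      ((hLd y).continuous.mul (continuous_const.mul hG)).integrable_of_hasCompactSupport
        (HasCompactSupport.mul_left (HasCompactSupport.mul_left hGc))
    have hi3 : Integrable fun x => J (x, y) :=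
      (hi1.sub hi2).congr (ae_of_all _ fun x => by simp [hdiv])
    simp only [hdiv]
    rw [integral_sub hi1 hi3, integral_const_mul, integral_divergence hF hFc]
    simp
  have hJs : Integrable (J ∘ Prod.swap) := hJ.swap
  have hJswap : ∫ p : Plane × Plane, J p = ∫ p : Plane × Plane, (J ∘ Prod.swap) p :=
    (integral_prod_swap (μ := (volume : Measure Plane)) (ν := (volume : Measure Plane)) J).symm
  have hsum : ∫ p : Plane × Plane, virialKernel X ε p * (ρ p.1 * ρ p.2)
      = 2 * ∫ p : Plane × Plane, J p := by
    have : ∀ p : Plane × Plane, virialKernel X ε p * (ρ p.1 * ρ p.2)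
        = J p + (J ∘ Prod.swap) p := by
      intro p
      simp only [virialKernel, J, Function.comp_apply, Fin.sum_univ_two, Prod.fst_swap, Prod.snd_swap,
        norm_sub_rev p.2 p.1]
      ring
    simp only [this]
    rw [integral_add hJ hJs, ← hJswap]
    ring
  rw [hsum, Measure.volume_eq_prod,
    integral_prod_symm _ (integrable_regLog_mul hε hε1 hρ hlog hG hGc)]
  simp only [inner]
  rw [integral_neg, ← integral_prod_symm _ hJ]
  ring

lemma abs_virialKernel_le {C : NNReal} (hL : ∀ i, LipschitzWith C (X i)) (hε : 0 ≤ ε)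
    (p : Plane × Plane) : |virialKernel X ε p| ≤ 2 * C := by
  have key (i : Fin 2) :
      |(X i p.1 - X i p.2) * ((p.1 i - p.2 i) / (‖p.1 - p.2‖ ^ 2 + ε))| ≤ C := by
    have h1 : |X i p.1 - X i p.2| ≤ C * ‖p.1 - p.2‖ := by
      simpa [dist_eq_norm] using (hL i).dist_le_mul p.1 p.2
    have h2 : |p.1 i - p.2 i| ≤ ‖p.1 - p.2‖ := abs_coord_le_norm (p.1 - p.2) i
    rw [abs_mul, abs_div, abs_of_nonneg (a := _ + ε) (by positivity), ← mul_div_assoc]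
    refine div_le_of_le_mul₀ (by positivity) (by positivity) ?_
    calc _ ≤ C * ‖p.1 - p.2‖ * ‖p.1 - p.2‖ := by gcongr
      _ ≤ _ := by nlinarith [mul_nonneg C.coe_nonneg hε]
  rw [virialKernel, Fin.sum_univ_two]
  linarith [abs_add_le _ _ |>.trans (add_le_add (key 0) (key 1))]

lemma measurable_virialKernel (hX : ∀ i, Continuous (X i)) : Measurable (virialKernel X ε) := by
  unfold virialKernel
  have (i : Fin 2) := (hX i).measurable
  fun_prop

lemma tendsto_virialKernel (p : Plane × Plane) :
    Tendsto (fun ε => virialKernel X ε p) (𝓝[>] 0) (𝓝 (virialKernel X 0 p)) := by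
  by_cases hp : p.1 = p.2
  · simp [virialKernel, hp]
  · have hz : 0 < ‖p.1 - p.2‖ := norm_pos_iff.2 (sub_ne_zero.2 hp)
    have hc : ContinuousAt (fun ε => virialKernel X ε p) 0 := by
      unfold virialKernel
      refine tendsto_finsetSum _ fun i _ => ?_
      exact continuousAt_const.mul (continuousAt_const.div (by fun_prop) (by positivity))
    exact hc.tendsto.mono_left nhdsWithin_le_nhds

lemma integral_logPotential_mul_divergence (hρc : ContDiff ℝ 1 ρ)
    (hρ : Integrable ρ) (hlog : Integrable fun x => Real.log (1 + ‖x‖) * ρ x)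
    (hX : ∀ i, ContDiff ℝ 1 (X i)) (hc : ∀ i, HasCompactSupport (X i))
    {C : NNReal} (hL : ∀ i, LipschitzWith C (X i)) :
    ∫ x, (∫ y, Real.log ‖x - y‖ * ρ y) * divergence (fun i x => X i x * ρ x) x
      = -(2⁻¹ * ∫ p : Plane × Plane, virialKernel X 0 p * (ρ p.1 * ρ p.2)) := by
  have hY (i) : ContDiff ℝ 1 (fun x => X i x * ρ x) := (hX i).mul hρc
  have hYc (i) : HasCompactSupport (fun x => X i x * ρ x) := (hc i).mul_right
  have hG := continuous_divergence hY
  have hGc := hasCompactSupport_divergence hYc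
  set G := divergence (fun i x => X i x * ρ x)
  have hfub : ∫ x, (∫ y, Real.log ‖x - y‖ * ρ y) * G x
      = ∫ p : Plane × Plane, Real.log ‖p.1 - p.2‖ * (ρ p.2 * G p.1) := by
    rw [Measure.volume_eq_prod, integral_prod _ (integrable_log_norm_mul hρ hlog hG hGc)]
    simp only [← integral_mul_const, mul_assoc]
  have hpos : ∀ᶠ ε : ℝ in 𝓝[>] 0, 0 < ε ∧ ε ≤ 1 := by
    filter_upwards [Ioc_mem_nhdsGT (zero_lt_one (α := ℝ))] with ε h using h
  have lim1 : Tendsto (fun ε => ∫ p : Plane × Plane, regLog ε (p.1 - p.2) * (ρ p.2 * G p.1))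
      (𝓝[>] 0) (𝓝 (∫ p : Plane × Plane, Real.log ‖p.1 - p.2‖ * (ρ p.2 * G p.1))) := by
    refine tendsto_integral_filter_of_dominated_convergence _ ?_ ?_
      (integrable_logWeight_mul hρ hlog hG hGc).norm ?_
    · filter_upwards [hpos] with ε h
      exact (integrable_regLog_mul h.1 h.2 hρ hlog hG hGc).aestronglyMeasurable
    · filter_upwards [hpos] with ε h
      filter_upwards [ae_fst_ne_snd] with p hp
      simp only [norm_mul]
      exact mul_le_mul_of_nonneg_right
        ((abs_regLog_le h.1 h.2 (sub_ne_zero.2 hp)).trans (le_abs_self _)) (by positivity)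
    · filter_upwards [ae_fst_ne_snd] with p hp
      exact (tendsto_regLog (sub_ne_zero.2 hp)).mul_const _
  have lim2 : Tendsto (fun ε => ∫ p : Plane × Plane, virialKernel X ε p * (ρ p.1 * ρ p.2))
      (𝓝[>] 0) (𝓝 (∫ p : Plane × Plane, virialKernel X 0 p * (ρ p.1 * ρ p.2))) := by
    refine tendsto_integral_filter_of_dominated_convergence _ ?_ ?_
      ((hρ.mul_prod hρ).norm.const_mul (2 * C)) ?_
    · exact Eventually.of_forall fun ε =>
        (measurable_virialKernel fun i => (hX i).continuous).aestronglyMeasurable.mul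
          (hρ.mul_prod hρ).aestronglyMeasurable
    · filter_upwards [hpos] with ε h
      refine ae_of_all _ fun p => ?_
      rw [norm_mul]
      exact mul_le_mul_of_nonneg_right (abs_virialKernel_le hL h.1.le p) (by positivity)
    · exact ae_of_all _ fun p => (tendsto_virialKernel p).mul_const _
  rw [hfub]
  refine tendsto_nhds_unique lim1 (((lim2.const_mul 2⁻¹).neg).congr' ?_)
  filter_upwards [hpos] with ε h
  exact (integral_regLog_mul_divergence h.1 h.2 hρc hρ hlog hX hc).symm

end LogKernel

section Cutoff

/-- A smooth compactly supported vector field that is the identity on the unit ball. -/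
def unitCutoffField (i : Fin 2) (x : Plane) : ℝ :=
  (⟨1, 2, one_pos, one_lt_two⟩ : ContDiffBump (0 : Plane)) x * x i

/-- The dilation of `unitCutoffField` that is the identity on the ball of radius `r⁻¹`. -/
def cutoffField (r : ℝ) (i : Fin 2) (x : Plane) : ℝ := r⁻¹ * unitCutoffField i (r • x)

lemma contDiff_unitCutoffField (i : Fin 2) {n : ℕ∞} : ContDiff ℝ n (unitCutoffField i) :=
  (ContDiffBump.contDiff _).mul (contDiff_piLp_apply (p := 2) (i := i))

lemma hasCompactSupport_unitCutoffField (i : Fin 2) : HasCompactSupport (unitCutoffField i) :=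
  (ContDiffBump.hasCompactSupport _).mul_right

lemma unitCutoffField_apply {i : Fin 2} {x : Plane} (hx : ‖x‖ ≤ 1) :
    unitCutoffField i x = x i := by
  rw [unitCutoffField, ContDiffBump.one_of_mem_closedBall _ (by simpa using hx), one_mul]

lemma partialDeriv_unitCutoffField_zero (i j : Fin 2) :
    partialDeriv j (unitCutoffField i) 0 = if i = j then 1 else 0 := by
  have h : unitCutoffField i =ᶠ[𝓝 0] fun x => EuclideanSpace.proj (𝕜 := ℝ) i x := by
    filter_upwards [Metric.closedBall_mem_nhds (0 : Plane) one_pos] with x hx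
    exact unitCutoffField_apply (by simpa using hx)
  rw [partialDeriv, h.fderiv_eq, ContinuousLinearMap.fderiv]
  simp

variable {r : ℝ}

lemma contDiff_cutoffField (i : Fin 2) {n : ℕ∞} : ContDiff ℝ n (cutoffField r i) :=
  contDiff_const.mul ((contDiff_unitCutoffField i).comp (contDiff_const_smul r))

lemma hasCompactSupport_cutoffField (hr : r ≠ 0) (i : Fin 2) :
    HasCompactSupport (cutoffField r i) :=
  HasCompactSupport.mul_left ((hasCompactSupport_unitCutoffField i).comp_smul hr)

lemma cutoffField_apply (hr : r ≠ 0) {i : Fin 2} {x : Plane} (hx : ‖r • x‖ ≤ 1) :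
    cutoffField r i x = x i := by
  rw [cutoffField, unitCutoffField_apply hx]
  simp [hr]

lemma partialDeriv_cutoffField (hr : r ≠ 0) (i j : Fin 2) (x : Plane) :
    partialDeriv j (cutoffField r i) x = partialDeriv j (unitCutoffField i) (r • x) := by
  have hd : Differentiable ℝ fun y : Plane => unitCutoffField i (r • y) :=
    ((contDiff_unitCutoffField i (n := 1)).comp
      (contDiff_const_smul r)).differentiable (by norm_num)
  unfold cutoffField
  rw [partialDeriv_const_mul _ (hd x), partialDeriv_comp_smul, inv_mul_cancel_left₀ hr]

lemma partialDeriv_divergence_cutoffField (hr : r ≠ 0) (j : Fin 2) (x : Plane) :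
    partialDeriv j (divergence (cutoffField r)) x
      = r * partialDeriv j (divergence unitCutoffField) (r • x) := by
  rw [← partialDeriv_comp_smul]
  congr 1
  ext y
  simp [divergence, partialDeriv_cutoffField hr]

lemma exists_lipschitzWith_cutoffField :
    ∃ C : NNReal, ∀ r, 0 < r → ∀ i, LipschitzWith C (cutoffField r i) := by
  choose K hK using fun i : Fin 2 => (contDiff_unitCutoffField i (n := 1)
    ).lipschitzWith_of_hasCompactSupport (hasCompactSupport_unitCutoffField i) (by norm_num)
  refine ⟨max (K 0) (K 1), fun r hr i => LipschitzWith.of_dist_le_mul fun x y => ?_⟩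
  have hi : K i ≤ max (K 0) (K 1) := by fin_cases i <;> simp
  have h := ((hK i).weaken hi).dist_le_mul (r • x) (r • y)
  rw [dist_smul₀, Real.norm_of_nonneg hr.le, Real.dist_eq] at h
  rw [Real.dist_eq, cutoffField, cutoffField, ← mul_sub, abs_mul, abs_of_pos (inv_pos.2 hr),
    inv_mul_le_iff₀ hr]
  linarith

lemma tendsto_virialKernel_cutoffField {p : Plane × Plane} (hp : p.1 ≠ p.2) :
    Tendsto (fun r => virialKernel (cutoffField r) 0 p) (𝓝[>] 0) (𝓝 1) := by
  have hz : ‖p.1 - p.2‖ ^ 2 ≠ 0 := by simpa [sub_eq_zero] using hp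
  have hsmall (x : Plane) : ∀ᶠ r : ℝ in 𝓝[>] 0, ‖r • x‖ ≤ 1 := by
    have hc : Tendsto (fun r : ℝ => ‖r • x‖) (𝓝 0) (𝓝 0) :=
      Continuous.tendsto' (by fun_prop) _ _ (by simp)
    exact nhdsWithin_le_nhds (hc.eventually_le_const one_pos)
  refine tendsto_const_nhds.congr' ?_
  filter_upwards [hsmall p.1, hsmall p.2, self_mem_nhdsWithin] with r h1 h2 hr
  have hr' : r ≠ 0 := ne_of_gt hr
  have hnorm : ‖p.1 - p.2‖ ^ 2 = (p.1 0 - p.2 0) ^ 2 + (p.1 1 - p.2 1) ^ 2 := by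
    simp [EuclideanSpace.norm_sq_eq]
  simp only [virialKernel, Fin.sum_univ_two, cutoffField_apply hr' h1, cutoffField_apply hr' h2,
    add_zero]
  rw [← mul_div_assoc, ← mul_div_assoc, ← add_div, eq_div_iff hz, hnorm]
  ring

variable {φ : Plane → ℝ}

lemma norm_fderiv_sq (x : Plane) :
    ‖fderiv ℝ φ x‖ ^ 2 = ∑ i, partialDeriv i φ x * partialDeriv i φ x := by
  set v := (InnerProductSpace.toDual ℝ Plane).symm (fderiv ℝ φ x)
  have hv (i : Fin 2) : v i = partialDeriv i φ x := by
    have : inner ℝ v (EuclideanSpace.single i (1 : ℝ)) = partialDeriv i φ x :=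
      InnerProductSpace.toDual_symm_apply
    simpa [EuclideanSpace.inner_single_right] using this
  have hn : ‖v‖ = ‖fderiv ℝ φ x‖ := LinearIsometryEquiv.norm_map _ _
  rw [← hn, EuclideanSpace.norm_sq_eq]
  simp [hv, pow_two]

lemma abs_partialDeriv_le (i : Fin 2) (x : Plane) : |partialDeriv i φ x| ≤ ‖fderiv ℝ φ x‖ := by
  simpa [partialDeriv] using (fderiv ℝ φ x).le_opNorm (EuclideanSpace.single i 1)

lemma tendsto_integral_pohozaevForm_cutoffField (hφ : ContDiff ℝ 2 φ)
    (hN : Integrable fun x => φ x ^ 2) (hT : Integrable fun x => ‖fderiv ℝ φ x‖ ^ 2) :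
    Tendsto (fun r => ∫ x, pohozaevForm (cutoffField r) φ x) (𝓝[>] 0)
      (𝓝 (∫ x, ‖fderiv ℝ φ x‖ ^ 2)) := by
  have hYc (i j) : Continuous (partialDeriv j (unitCutoffField i)) :=
    (contDiff_partialDeriv (m := 0) (contDiff_unitCutoffField i (n := 1)) (by norm_num)).continuous
  have hDc (j) : Continuous (partialDeriv j (divergence unitCutoffField)) :=
    (contDiff_partialDeriv (m := 0)
      (contDiff_divergence fun i => contDiff_unitCutoffField i (n := 2)) (by norm_num)).continuous
  choose A hA using fun i j : Fin 2 =>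
    (hasCompactSupport_unitCutoffField i).partialDeriv.exists_bound_of_continuous (hYc i j)
  choose B hB using fun j : Fin 2 => (hasCompactSupport_divergence
    hasCompactSupport_unitCutoffField).partialDeriv.exists_bound_of_continuous (hDc j)
  have hform (r : ℝ) (hr : r ≠ 0) (x) : pohozaevForm (cutoffField r) φ x
      = ∑ j, ((∑ i, partialDeriv j (unitCutoffField i) (r • x)
          * partialDeriv i φ x * partialDeriv j φ x)
        + 2⁻¹ * (φ x * partialDeriv j φ x
          * (r * partialDeriv j (divergence unitCutoffField) (r • x)))) := by
    simp only [pohozaevForm, partialDeriv_cutoffField hr, partialDeriv_divergence_cutoffField hr]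
  have hpc (i) : Continuous (partialDeriv i φ) :=
    (contDiff_partialDeriv (m := 1) hφ (by norm_num)).continuous
  have hφc := hφ.continuous
  have hpos : ∀ᶠ r : ℝ in 𝓝[>] 0, 0 < r ∧ r ≤ 1 := by
    filter_upwards [Ioc_mem_nhdsGT (zero_lt_one (α := ℝ))] with r h using h
  refine tendsto_integral_filter_of_dominated_convergence
    (fun x => ∑ j, ((∑ i, A i j * ‖fderiv ℝ φ x‖ ^ 2)
      + 2⁻¹ * (B j * (φ x ^ 2 + ‖fderiv ℝ φ x‖ ^ 2)))) ?_ ?_ ?_ ?_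
  · filter_upwards [hpos] with r hr
    rw [show pohozaevForm (cutoffField r) φ = _ from funext (hform r hr.1.ne')]
    exact Continuous.aestronglyMeasurable (by fun_prop)
  · filter_upwards [hpos] with r hr
    refine ae_of_all _ fun x => ?_
    rw [hform r hr.1.ne']
    have hG := norm_nonneg (fderiv ℝ φ x)
    refine (norm_sum_le _ _).trans (Finset.sum_le_sum fun j _ => (norm_add_le _ _).trans
      (add_le_add ((norm_sum_le _ _).trans (Finset.sum_le_sum fun i _ => ?_)) ?_))
    · have hA0 : 0 ≤ A i j := (norm_nonneg _).trans (hA i j 0)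
      rw [norm_mul, norm_mul, mul_assoc, pow_two]
      exact mul_le_mul (hA i j _) (mul_le_mul (abs_partialDeriv_le i x) (abs_partialDeriv_le j x)
        (norm_nonneg _) hG) (by positivity) hA0
    · have hB0 : 0 ≤ B j := (norm_nonneg _).trans (hB j 0)
      rw [norm_mul, norm_mul, norm_mul, norm_mul, Real.norm_of_nonneg (by norm_num : (0:ℝ) ≤ 2⁻¹),
        Real.norm_of_nonneg hr.1.le]
      refine mul_le_mul_of_nonneg_left ?_ (by norm_num)
      have h1 : ‖φ x‖ * ‖partialDeriv j φ x‖ ≤ φ x ^ 2 + ‖fderiv ℝ φ x‖ ^ 2 := by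
        have := mul_le_mul_of_nonneg_left (abs_partialDeriv_le (φ := φ) j x) (abs_nonneg (φ x))
        rw [Real.norm_eq_abs, Real.norm_eq_abs]
        nlinarith [sq_abs (φ x), sq_nonneg (|φ x| - ‖fderiv ℝ φ x‖)]
      have h2 : r * ‖partialDeriv j (divergence unitCutoffField) (r • x)‖ ≤ B j :=
        (mul_le_mul hr.2 (hB j _) (norm_nonneg _) zero_le_one).trans_eq (one_mul _)
      rw [mul_comm (B j)]
      exact mul_le_mul h1 h2 (mul_nonneg hr.1.le (norm_nonneg _)) (by positivity)
  · exact integrable_finsetSum _ fun j _ => (integrable_finsetSum _ fun i _ =>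
      hT.const_mul _).add (((hN.add hT).const_mul _).const_mul _)
  · refine ae_of_all _ fun x => ?_
    have hlim : Tendsto (fun r : ℝ => ∑ j, ((∑ i, partialDeriv j (unitCutoffField i) (r • x)
          * partialDeriv i φ x * partialDeriv j φ x)
        + 2⁻¹ * (φ x * partialDeriv j φ x
          * (r * partialDeriv j (divergence unitCutoffField) (r • x))))) (𝓝 0)
        (𝓝 (‖fderiv ℝ φ x‖ ^ 2)) := by
      refine Continuous.tendsto' (by fun_prop) _ _ ?_
      simp [partialDeriv_unitCutoffField_zero, norm_fderiv_sq]
    refine (hlim.mono_left nhdsWithin_le_nhds).congr' ?_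
    filter_upwards [hpos] with r hr using (hform r hr.1.ne' x).symm

lemma tendsto_integral_virialKernel_cutoffField {ρ : Plane → ℝ} (hρ : Integrable ρ) :
    Tendsto (fun r => ∫ p : Plane × Plane, virialKernel (cutoffField r) 0 p * (ρ p.1 * ρ p.2))
      (𝓝[>] 0) (𝓝 ((∫ x, ρ x) ^ 2)) := by
  obtain ⟨C, hC⟩ := exists_lipschitzWith_cutoffField
  have hsq : (∫ x, ρ x) ^ 2 = ∫ p : Plane × Plane, ρ p.1 * ρ p.2 := by
    rw [pow_two, Measure.volume_eq_prod, integral_prod_mul]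
  rw [hsq]
  refine tendsto_integral_filter_of_dominated_convergence _ ?_ ?_
    ((hρ.mul_prod hρ).norm.const_mul (2 * C)) ?_
  · exact Eventually.of_forall fun r =>
      (measurable_virialKernel fun i => (contDiff_cutoffField i (n := 0)
        ).continuous).aestronglyMeasurable.mul (hρ.mul_prod hρ).aestronglyMeasurable
  · filter_upwards [self_mem_nhdsWithin] with r hr
    refine ae_of_all _ fun p => ?_
    rw [norm_mul]
    exact mul_le_mul_of_nonneg_right (abs_virialKernel_le (hC r hr) le_rfl p) (by positivity)
  · filter_upwards [ae_fst_ne_snd] with p hp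
    simpa using (tendsto_virialKernel_cutoffField hp).mul_const (ρ p.1 * ρ p.2)

end Cutoff

lemma integral_pohozaevForm_eq {A ω : ℝ} {φ : Plane → ℝ} {X : Fin 2 → Plane → ℝ}
    (hφ : ContDiff ℝ 2 φ)
    (hpde : ∀ x, -laplacian φ x + A * (∫ y, Real.log ‖x - y‖ * φ y ^ 2) * φ x = ω * φ x)
    (hN : Integrable fun x => φ x ^ 2)
    (hlog : Integrable fun x => Real.log (1 + ‖x‖) * φ x ^ 2)
    (hX : ∀ i, ContDiff ℝ 2 (X i)) (hc : ∀ i, HasCompactSupport (X i))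
    {C : NNReal} (hL : ∀ i, LipschitzWith C (X i)) :
    ∫ x, pohozaevForm X φ x
      = A / 4 * ∫ p : Plane × Plane, virialKernel X 0 p * (φ p.1 ^ 2 * φ p.2 ^ 2) := by
  have hX1 (i) : ContDiff ℝ 1 (X i) := (hX i).of_le (by norm_num)
  have hρ : ContDiff ℝ 1 fun x => φ x ^ 2 := (hφ.of_le (by norm_num)).pow 2
  have hY (i) : ContDiff ℝ 1 fun x => X i x * φ x ^ 2 := (hX1 i).mul hρ
  have hYc (i) : HasCompactSupport fun x => X i x * φ x ^ 2 := (hc i).mul_right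
  have hpot := integral_logPotential_mul_divergence hρ hN hlog hX1 hc hL
  have hform := integral_laplacian_mul_pohozaevMultiplier hφ hX hc
  have hpt (x) : A * ((∫ y, Real.log ‖x - y‖ * φ y ^ 2)
        * divergence (fun i x => X i x * φ x ^ 2) x)
      = ω * divergence (fun i x => X i x * φ x ^ 2) x
        + 2 * (laplacian φ x * pohozaevMultiplier X φ x) := by
    rw [← two_mul_mul_pohozaevMultiplier hφ hX]
    linear_combination (2 * pohozaevMultiplier X φ x) * hpde x
  have hzero : A * ∫ x, (∫ y, Real.log ‖x - y‖ * φ y ^ 2)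
        * divergence (fun i x => X i x * φ x ^ 2) x
      = 2 * ∫ x, laplacian φ x * pohozaevMultiplier X φ x := by
    rw [← integral_const_mul]
    simp only [hpt]
    rw [integral_add
      (((continuous_divergence hY).integrable_of_hasCompactSupport
        (hasCompactSupport_divergence hYc)).const_mul ω)
      ((integrable_laplacian_mul_pohozaevMultiplier hφ hX hc).const_mul 2),
      integral_const_mul, integral_const_mul, integral_divergence hY hYc]
    ring
  rw [hpot, hform] at hzero
  linarith

/-- Virial identity `T(φ_ω) = (γ/8π) N(φ_ω)²` for decaying solutions of the
stationary 2D Schrödinger–Newton equation. -/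
theorem virial_identity (γ ω : ℝ) (hγ : 0 < γ)
    (φ : EuclideanSpace ℝ (Fin 2) → ℝ)
    (hreg : ContDiff ℝ 2 φ)
    (hpde : ∀ x, -laplacian φ x
        + (γ / (2 * Real.pi)) * (∫ y, Real.log ‖x - y‖ * φ y ^ 2) * φ x
      = ω * φ x)
    (hN : Integrable (fun x => φ x ^ 2))
    (hT : Integrable (fun x => ‖fderiv ℝ φ x‖ ^ 2))
    (hX : Integrable (fun x => Real.log (1 + ‖x‖) * φ x ^ 2))
    (hV : Integrable (fun p : EuclideanSpace ℝ (Fin 2) × EuclideanSpace ℝ (Fin 2) =>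
      Real.log ‖p.1 - p.2‖ * φ p.1 ^ 2 * φ p.2 ^ 2))
    (hdecay : Integrable (fun x => ‖x‖ * ‖fderiv ℝ φ x‖ * |φ x|)) :
    (∫ x, ‖fderiv ℝ φ x‖ ^ 2) = (γ / (8 * Real.pi)) * (∫ x, φ x ^ 2) ^ 2 := by
  obtain ⟨C, hC⟩ := exists_lipschitzWith_cutoffField
  have hlim := ((tendsto_integral_virialKernel_cutoffField hN).const_mul
    (γ / (2 * Real.pi) / 4))
  have hA : γ / (8 * Real.pi) = γ / (2 * Real.pi) / 4 := by field_simp; norm_num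
  rw [hA]
  refine tendsto_nhds_unique (tendsto_integral_pohozaevForm_cutoffField hreg hN hT)
    (hlim.congr' ?_)
  filter_upwards [self_mem_nhdsWithin] with r hr
  exact (integral_pohozaevForm_eq hreg hpde hN hX (fun i => contDiff_cutoffField i (n := 2))
    (hasCompactSupport_cutoffField (ne_of_gt hr)) (hC r hr)).symm
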